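/- Let G be a digraph on n vertices with no self-loops containing a reverse directed spanning tree, with weights a_{ij} > 0 and weighted Laplacian L. Then: (a) for x = (x_1,…,x_n) ∈ (ℝ²)ⁿ, (L ⊗ I₂)x = 0 if and only if x_1 = x_2 = ⋯ = x_n; (b) the linear map T : (ℝ²)ⁿ → (ℝ²)ⁿ × ℝ² defined by T(x) = ((L ⊗ I₂)x, Σ_{i=1}^n x_i) is injective. -/

import Mathlib

open scoped BigOperators Kronecker

/-- The weighted Laplacian `L = D - A` of a digraph with edge relation `Adj` and
weights `a`. -/
noncomputable def lap {n : ℕ} (Adj : Fin n → Fin n → Bool) (a : Fin n → Fin n → ℝ) :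
    Matrix (Fin n) (Fin n) ℝ :=
  Matrix.diagonal (fun i => ∑ j, if Adj i j = true then a i j else 0) -
    Matrix.of fun i j => if Adj i j = true then a i j else 0

/-- Entrywise form of the Laplacian: `(L f) i = ∑ j ∈ N_i, a i j * (f i - f j)`. -/
theorem lap_mulVec_apply {n : ℕ} (Adj : Fin n → Fin n → Bool) (a : Fin n → Fin n → ℝ)
    (f : Fin n → ℝ) (i : Fin n) :
    (lap Adj a).mulVec f i = ∑ j, if Adj i j = true then a i j * (f i - f j) else 0 := by
  rw [lap, Matrix.sub_mulVec, Pi.sub_apply, Matrix.mulVec_diagonal, Finset.sum_mul]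
  simp only [Matrix.mulVec, dotProduct, Matrix.of_apply]
  rw [← Finset.sum_sub_distrib]
  refine Finset.sum_congr rfl fun j _ => ?_
  split_ifs <;> ring

/-- Maximum principle: a function harmonic for the Laplacian is bounded above by its value at
any vertex reachable from every vertex. -/
theorem le_apply_root_of_lap_mulVec_eq_zero {n : ℕ} {Adj : Fin n → Fin n → Bool}
    {a : Fin n → Fin n → ℝ} (ha : ∀ i j, Adj i j = true → 0 < a i j) {r : Fin n}
    (hr : ∀ i, Relation.ReflTransGen (fun p q => Adj p q = true) i r)
    {f : Fin n → ℝ} (hf : (lap Adj a).mulVec f = 0) (i : Fin n) : f i ≤ f r := by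
  have : Nonempty (Fin n) := ⟨r⟩
  obtain ⟨m, hm⟩ := Finite.exists_max f
  have hstep : ∀ p q, Adj p q = true → f p = f m → f q = f m := by
    intro p q hpq hp
    have hsum := congrFun hf p
    rw [lap_mulVec_apply, Pi.zero_apply, Finset.sum_eq_zero_iff_of_nonneg] at hsum
    · have hq := hsum q (Finset.mem_univ q)
      rw [if_pos hpq, mul_eq_zero, or_iff_right (ha p q hpq).ne'] at hq
      linarith
    · intro j _
      split_ifs with hj
      · exact mul_nonneg (ha p j hj).le (by linarith [hm j])
      · exact le_rfl
  have hroot : f r = f m := by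
    have hpath := hr m
    clear hr
    induction hpath with
    | refl => rfl
    | tail _ hbc ih => exact hstep _ _ hbc ih
  exact hroot ▸ hm i

/-- The kernel of the Laplacian consists of the constant functions. -/
theorem lap_mulVec_eq_zero_iff {n : ℕ} {Adj : Fin n → Fin n → Bool}
    {a : Fin n → Fin n → ℝ} (ha : ∀ i j, Adj i j = true → 0 < a i j)
    (htree : ∃ r : Fin n, ∀ i, Relation.ReflTransGen (fun p q => Adj p q = true) i r)
    (f : Fin n → ℝ) : (lap Adj a).mulVec f = 0 ↔ ∀ i j, f i = f j := by
  obtain ⟨r, hr⟩ := htree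
  constructor
  · intro hf
    have hneg : (lap Adj a).mulVec (-f) = 0 := by rw [Matrix.mulVec_neg, hf, neg_zero]
    have hconst : ∀ i, f i = f r := fun i =>
      le_antisymm (le_apply_root_of_lap_mulVec_eq_zero ha hr hf i)
        (neg_le_neg_iff.mp (le_apply_root_of_lap_mulVec_eq_zero ha hr hneg i))
    exact fun i j => (hconst i).trans (hconst j).symm
  · intro h
    ext i
    rw [lap_mulVec_apply]
    exact Finset.sum_eq_zero fun j _ => by rw [h i j, sub_self, mul_zero, ite_self]

/-- `M ⊗ I` acts coordinatewise. -/
theorem kronecker_one_mulVec_apply {m n k R : Type*} [Fintype n] [Fintype k] [DecidableEq k]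
    [NonAssocSemiring R] (M : Matrix m n R) (x : n → k → R) (i : m) (c : k) :
    (M ⊗ₖ (1 : Matrix k k R)).mulVec (fun p => x p.1 p.2) (i, c) =
      M.mulVec (fun j => x j c) i := by
  simp [Matrix.mulVec, dotProduct, Fintype.sum_prod_type, Matrix.one_apply]

/-- if the digraph (no self-loops, positive weights) contains a reverse
directed spanning tree then (a) `(L ⊗ I₂)x = 0 ↔ x₁ = ⋯ = xₙ`, and (b) the map
`T(x) = ((L ⊗ I₂)x, Σᵢ xᵢ)` is injective. -/
theorem laplacian_kronecker_kernel_and_injectivity {n : ℕ}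
    (Adj : Fin n → Fin n → Bool) (hloop : ∀ i, Adj i i = false)
    (a : Fin n → Fin n → ℝ) (ha : ∀ i j, Adj i j = true → 0 < a i j)
    (htree : ∃ r : Fin n, ∀ i, Relation.ReflTransGen (fun p q => Adj p q = true) i r) :
    (∀ x : Fin n → Fin 2 → ℝ,
        (lap Adj a ⊗ₖ (1 : Matrix (Fin 2) (Fin 2) ℝ)).mulVec (fun p => x p.1 p.2) = 0 ↔
          ∀ i j, x i = x j) ∧
    Function.Injective (fun x : Fin n → Fin 2 → ℝ =>
      ((lap Adj a ⊗ₖ (1 : Matrix (Fin 2) (Fin 2) ℝ)).mulVec fun p => x p.1 p.2,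
        ∑ i, x i)) := by
  have hker : ∀ x : Fin n → Fin 2 → ℝ,
      (lap Adj a ⊗ₖ (1 : Matrix (Fin 2) (Fin 2) ℝ)).mulVec (fun p => x p.1 p.2) = 0 ↔
        ∀ i j, x i = x j := by
    intro x
    have hcoord := fun c => lap_mulVec_eq_zero_iff ha htree (fun j => x j c)
    constructor
    · intro h i j
      funext c
      refine (hcoord c).mp (funext fun i => ?_) i j
      rw [← kronecker_one_mulVec_apply, h]
      rfl
    · rintro h
      funext ⟨i, c⟩
      rw [kronecker_one_mulVec_apply, (hcoord c).mpr fun i j => congrFun (h i j) c]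
      rfl
  refine ⟨hker, fun x y hxy => ?_⟩
  obtain ⟨hL, hS⟩ := Prod.ext_iff.mp hxy
  have hconst : ∀ i j, (x - y) i = (x - y) j := by
    refine (hker (x - y)).mp ?_
    exact (Matrix.mulVec_sub _ (fun p : Fin n × Fin 2 => x p.1 p.2) fun p => y p.1 p.2).trans
      (sub_eq_zero.mpr hL)
  have hsum : ∑ i, (x - y) i = 0 := by
    simpa [Finset.sum_sub_distrib, sub_eq_zero] using hS
  funext i
  rw [Finset.sum_congr rfl fun j _ => hconst j i, Finset.sum_const, Finset.card_univ,
    Fintype.card_fin, smul_eq_zero] at hsum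
  exact sub_eq_zero.mp (hsum.resolve_left i.pos.ne')
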